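/- Let x_3 < x_2 < x_1 < 0, set y_1 = x_1 - x_3, y_2 = x_2 - x_3, and define α = (y_1/2)[(y_1 - y_2)/3 + x_3 - (E(k*)/K(k*))((y_1+y_2)/3 + x_3)] with k* = sqrt(y_2/y_1), and p(z) = -z^2 + (z/2)(y_1 + y_2 - x_3) + α. Then p(y_1) = (y_1/6)[2(x_2 - x_1) - (E(k*)/K(k*))(x_1 + x_2 + x_3)] and in particular p(y_1) > 0. -/

import Mathlib

noncomputable def ellK (k : ℝ) : ℝ :=
  ∫ x in (0:ℝ)..1, 1 / Real.sqrt ((1 - x ^ 2) * (1 - k ^ 2 * x ^ 2))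

noncomputable def ellE (k : ℝ) : ℝ :=
  ∫ x in (0:ℝ)..1, Real.sqrt (1 - k ^ 2 * x ^ 2) / Real.sqrt (1 - x ^ 2)

theorem intervalIntegrable_inv_sqrt_one_sub_sq :
    IntervalIntegrable (fun x : ℝ => (Real.sqrt (1 - x ^ 2))⁻¹) MeasureTheory.volume 0 1 := by
  refine intervalIntegral.intervalIntegrable_deriv_of_nonneg (g := Real.arcsin)
    Real.continuous_arcsin.continuousOn (fun x hx => ?_) fun x _ => by positivity
  simp only [zero_le_one, min_eq_left, max_eq_right, Set.mem_Ioo] at hx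
  simpa using Real.hasDerivAt_arcsin (by linarith : x ≠ -1) (by linarith : x ≠ 1)

theorem one_sub_sq_mul_sq_pos {k x : ℝ} (h0 : 0 ≤ k) (h1 : k < 1) (hx : x ∈ Set.Icc (0 : ℝ) 1) :
    0 < 1 - k ^ 2 * x ^ 2 := by
  have hk : k ^ 2 < 1 := by nlinarith
  have hx2 : x ^ 2 ≤ 1 := by nlinarith [hx.1, hx.2]
  nlinarith [sq_nonneg k, sq_nonneg x]

/-- Integrating a function of the modular factor `√(1 - k² x²)` against the arcsine weight. -/
theorem intervalIntegrable_comp_mul_inv_sqrt {k : ℝ} (h0 : 0 ≤ k) (h1 : k < 1) {g : ℝ → ℝ}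
    (hg : ContinuousOn g (Set.Ioi 0)) :
    IntervalIntegrable (fun x : ℝ => g (Real.sqrt (1 - k ^ 2 * x ^ 2)) * (Real.sqrt (1 - x ^ 2))⁻¹)
      MeasureTheory.volume 0 1 := by
  refine intervalIntegrable_inv_sqrt_one_sub_sq.continuousOn_mul ?_
  rw [Set.uIcc_of_le zero_le_one]
  exact hg.comp (by fun_prop) fun x hx => Real.sqrt_pos.2 (one_sub_sq_mul_sq_pos h0 h1 hx)

theorem hasDerivAt_mul_sqrt_div_sqrt {k x : ℝ} (h0 : 0 ≤ k) (h1 : k < 1)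
    (hx : x ∈ Set.Ioo (0 : ℝ) 1) :
    HasDerivAt (fun x : ℝ => k ^ 2 * (x * Real.sqrt (1 - x ^ 2) / Real.sqrt (1 - k ^ 2 * x ^ 2)))
      ((Real.sqrt (1 - k ^ 2 * x ^ 2) - (1 - k ^ 2) / Real.sqrt (1 - k ^ 2 * x ^ 2) ^ 3)
        * (Real.sqrt (1 - x ^ 2))⁻¹) x := by
  have ht := one_sub_sq_mul_sq_pos h0 h1 (Set.Ioo_subset_Icc_self hx)
  have hu : 0 < 1 - x ^ 2 := by nlinarith [hx.1, hx.2]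
  have du : HasDerivAt (fun x : ℝ => 1 - x ^ 2) (-(2 * x)) x := by
    simpa using (hasDerivAt_pow 2 x).const_sub 1
  have dt : HasDerivAt (fun x : ℝ => 1 - k ^ 2 * x ^ 2) (-(k ^ 2 * (2 * x))) x := by
    simpa using ((hasDerivAt_pow 2 x).const_mul (k ^ 2)).const_sub 1
  have h := ((((hasDerivAt_id x).mul (du.sqrt hu.ne')).div (dt.sqrt ht.ne')
    (Real.sqrt_pos.2 ht).ne').const_mul (k ^ 2))
  refine h.congr_deriv ?_
  have hu2 := Real.sq_sqrt hu.le
  have ht2 := Real.sq_sqrt ht.le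
  have hup := Real.sqrt_pos.2 hu
  have htp := Real.sqrt_pos.2 ht
  simp only [id, Pi.mul_apply]
  set u := Real.sqrt (1 - x ^ 2)
  set t := Real.sqrt (1 - k ^ 2 * x ^ 2)
  have ht4 : t ^ 4 = (1 - k ^ 2 * x ^ 2) ^ 2 := by rw [← ht2]; ring
  field_simp
  ring_nf
  simp only [hu2, ht2, ht4]
  ring

theorem intervalIntegrable_sqrt_sub_div_sqrt_pow_three {k : ℝ} (h0 : 0 ≤ k) (h1 : k < 1) :
    IntervalIntegrable (fun x : ℝ =>
      (Real.sqrt (1 - k ^ 2 * x ^ 2) - (1 - k ^ 2) / Real.sqrt (1 - k ^ 2 * x ^ 2) ^ 3)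
        * (Real.sqrt (1 - x ^ 2))⁻¹) MeasureTheory.volume 0 1 :=
  intervalIntegrable_comp_mul_inv_sqrt h0 h1 (g := fun t => t - (1 - k ^ 2) / t ^ 3)
    (continuousOn_id.sub (continuousOn_const.div (by fun_prop)
      fun _ ht => pow_ne_zero 3 (ne_of_gt ht)))

theorem integral_sqrt_sub_div_sqrt_pow_three {k : ℝ} (h0 : 0 ≤ k) (h1 : k < 1) :
    ∫ x in (0:ℝ)..1,
      (Real.sqrt (1 - k ^ 2 * x ^ 2) - (1 - k ^ 2) / Real.sqrt (1 - k ^ 2 * x ^ 2) ^ 3)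
        * (Real.sqrt (1 - x ^ 2))⁻¹ = 0 := by
  have hc : ContinuousOn (fun x : ℝ =>
      k ^ 2 * (x * Real.sqrt (1 - x ^ 2) / Real.sqrt (1 - k ^ 2 * x ^ 2))) (Set.Icc 0 1) := by
    refine continuousOn_const.mul (ContinuousOn.div (by fun_prop) (by fun_prop) fun x hx => ?_)
    exact (Real.sqrt_pos.2 (one_sub_sq_mul_sq_pos h0 h1 hx)).ne'
  rw [intervalIntegral.integral_eq_sub_of_hasDerivAt_of_le zero_le_one hc
    (fun x hx => hasDerivAt_mul_sqrt_div_sqrt h0 h1 hx)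
    (intervalIntegrable_sqrt_sub_div_sqrt_pow_three h0 h1)]
  simp

theorem ellE_eq (k : ℝ) :
    ellE k = ∫ x in (0:ℝ)..1, Real.sqrt (1 - k ^ 2 * x ^ 2) * (Real.sqrt (1 - x ^ 2))⁻¹ := by
  simp only [ellE, div_eq_mul_inv]

theorem ellK_eq (k : ℝ) :
    ellK k = ∫ x in (0:ℝ)..1, (Real.sqrt (1 - k ^ 2 * x ^ 2))⁻¹ * (Real.sqrt (1 - x ^ 2))⁻¹ := by
  refine intervalIntegral.integral_congr fun x hx => ?_
  rw [Set.uIcc_of_le zero_le_one] at hx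
  have hu : 0 ≤ 1 - x ^ 2 := by nlinarith [hx.1, hx.2]
  simp only [Real.sqrt_mul hu, one_div, mul_inv, mul_comm]

theorem continuousOn_inv_Ioi : ContinuousOn (fun t : ℝ => t⁻¹) (Set.Ioi 0) :=
  continuousOn_id.inv₀ fun _ ht => ne_of_gt ht

theorem ellK_pos {k : ℝ} (h0 : 0 ≤ k) (h1 : k < 1) : 0 < ellK k := by
  rw [ellK_eq]
  refine intervalIntegral.intervalIntegral_pos_of_pos_on
    (intervalIntegrable_comp_mul_inv_sqrt h0 h1 continuousOn_inv_Ioi) (fun x hx => ?_) one_pos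
  have ht := one_sub_sq_mul_sq_pos h0 h1 (Set.Ioo_subset_Icc_self hx)
  have hu : 0 < 1 - x ^ 2 := by nlinarith [hx.1, hx.2]
  positivity

/-- `E - k' K = ½ ∫ (t² - k')² / t³ · dx / √(1 - x²)` with `t = √(1 - k² x²)`, `k' = √(1 - k²)`. -/
theorem sqrt_mul_ellK_le_ellE {k : ℝ} (h0 : 0 ≤ k) (h1 : k < 1) :
    Real.sqrt (1 - k ^ 2) * ellK k ≤ ellE k := by
  have hk : 0 ≤ 1 - k ^ 2 := by nlinarith
  have hI := integral_sqrt_sub_div_sqrt_pow_three h0 h1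
  have iE := intervalIntegrable_comp_mul_inv_sqrt h0 h1 (g := fun t => t) continuousOn_id
  have iK := intervalIntegrable_comp_mul_inv_sqrt h0 h1 continuousOn_inv_Ioi
  have iF := intervalIntegrable_sqrt_sub_div_sqrt_pow_three h0 h1
  have key := intervalIntegral.integral_mono_on zero_le_one
    ((iK.const_mul (Real.sqrt (1 - k ^ 2))).add (iF.const_mul (1 / 2))) iE fun x hx => ?_
  · rw [intervalIntegral.integral_add (iK.const_mul _) (iF.const_mul _),
      intervalIntegral.integral_const_mul, intervalIntegral.integral_const_mul, hI,
      ← ellK_eq, ← ellE_eq] at key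
    linarith
  · have htp := Real.sqrt_pos.2 (one_sub_sq_mul_sq_pos h0 h1 hx)
    have hk2 := Real.sq_sqrt hk
    set t := Real.sqrt (1 - k ^ 2 * x ^ 2)
    set c := Real.sqrt (1 - k ^ 2)
    rw [← hk2, ← mul_assoc, ← mul_assoc, ← add_mul]
    refine mul_le_mul_of_nonneg_right ?_ (by positivity)
    have h : t - (c * t⁻¹ + 1 / 2 * (t - c ^ 2 / t ^ 3)) = (t ^ 2 - c) ^ 2 / (2 * t ^ 3) := by
      field_simp
      ring
    have : 0 ≤ (t ^ 2 - c) ^ 2 / (2 * t ^ 3) := by positivity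
    linarith

theorem stmt_6 (x₁ x₂ x₃ : ℝ) (h32 : x₃ < x₂) (h21 : x₂ < x₁) (h10 : x₁ < 0)
    (y₁ y₂ kstar α : ℝ) (p : ℝ → ℝ)
    (hy1 : y₁ = x₁ - x₃) (hy2 : y₂ = x₂ - x₃)
    (hk : kstar = Real.sqrt (y₂ / y₁))
    (hα : α = (y₁ / 2) * ((y₁ - y₂) / 3 + x₃ -
      (ellE kstar / ellK kstar) * ((y₁ + y₂) / 3 + x₃)))
    (hp : ∀ z, p z = -z ^ 2 + (z / 2) * (y₁ + y₂ - x₃) + α) :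
    p y₁ = (y₁ / 6) * (2 * (x₂ - x₁) - (ellE kstar / ellK kstar) * (x₁ + x₂ + x₃))
      ∧ 0 < p y₁ := by
  have hval : p y₁ =
      (y₁ / 6) * (2 * (x₂ - x₁) - (ellE kstar / ellK kstar) * (x₁ + x₂ + x₃)) := by
    rw [hp, hα, hy1, hy2]
    ring
  refine ⟨hval, hval ▸ ?_⟩
  have hy1p : 0 < y₁ := by linarith
  have hy2p : 0 < y₂ := by linarith
  have hk0 : 0 ≤ kstar := hk ▸ Real.sqrt_nonneg _
  have hk2 : kstar ^ 2 = y₂ / y₁ := by rw [hk, Real.sq_sqrt (by positivity)]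
  have hlt : y₂ / y₁ < 1 := (div_lt_one hy1p).2 (by linarith)
  have hk1 : kstar < 1 := by nlinarith
  have hr := (le_div_iff₀ (ellK_pos hk0 hk1)).2 (sqrt_mul_ellK_le_ellE hk0 hk1)
  have hc := Real.sqrt_pos.2 (show 0 < 1 - kstar ^ 2 by rw [hk2]; linarith)
  have hc2 := Real.sq_sqrt (show 0 ≤ 1 - kstar ^ 2 by rw [hk2]; linarith)
  set r := ellE kstar / ellK kstar
  set c := Real.sqrt (1 - kstar ^ 2)
  have hcy : c ^ 2 * y₁ = x₁ - x₂ := by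
    rw [hc2, hk2, sub_mul, div_mul_cancel₀ _ hy1p.ne']
    linarith
  -- `-(x₁ + x₂ + x₃) > (x₁ - x₂) + (x₁ - x₃) = (1 + c²) y₁ ≥ 2 c y₁`
  have hS : 2 * (c * y₁) < -(x₁ + x₂ + x₃) := by
    nlinarith [mul_nonneg hy1p.le (sq_nonneg (1 - c))]
  have hrS : c * -(x₁ + x₂ + x₃) ≤ r * -(x₁ + x₂ + x₃) :=
    mul_le_mul_of_nonneg_right hr (by linarith)
  have hcS := mul_lt_mul_of_pos_left hS hc
  exact mul_pos (by positivity) (by nlinarith)
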